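/- arXiv:2206.11369 — 3 statements merged into one kernel-verified Lean document; each statement's English description precedes it below -/
import Mathlib

section
/- Fix β > 0, x ∈ 𝒳, x̂ ∈ 𝒳̂, and a point r ∈ ℝ^{𝒳̂} with Z(x,β) = ∑_{x̂'} r(x̂')·e^{−β d(x,x̂')} > 0. For every k ≥ 1 and every tuple of indices x̂_{i_1}, …, x̂_{i_k} ∈ 𝒳̂ (repetitions allowed), the iterated partial derivative of the map r ↦ q[r](x̂|x) satisfies ∂^k q[r](x̂|x) / ∂r(x̂_{i_1})⋯∂r(x̂_{i_k}) = [(−1)^{k−1}·(k−1)!·e^{−β ∑_{j=1}^k d(x, x̂_{i_j})} / Z(x,β)^k] · [ ∑_{j=1}^k δ_{x̂, x̂_{i_j}} − k·q[r](x̂|x) ], where δ is the Kronecker delta. -/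
open scoped BigOperators

variable {X Xhat : Type*} [Fintype X] [Fintype Xhat] [DecidableEq Xhat]

/-- The partition function `Z(x, β) = ∑_{x̂'} r(x̂')·e^{−β d(x,x̂')}`. -/
noncomputable def Zf (d : X → Xhat → ℝ) (r : Xhat → ℝ) (β : ℝ) (x : X) : ℝ :=
  ∑ xh' : Xhat, r xh' * Real.exp (-β * d x xh')

/-- The encoder `q[r](x̂|x) = r(x̂)·e^{−β d(x,x̂)} / Z(x,β)`. -/
noncomputable def enc (d : X → Xhat → ℝ) (r : Xhat → ℝ) (β : ℝ) (xh : Xhat) (x : X) : ℝ :=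
  r xh * Real.exp (-β * d x xh) / Zf d r β x

/-- Partial derivative of a function of `r ∈ ℝ^{𝒳̂}` with respect to the coordinate `r(j)`. -/
noncomputable def pd (j : Xhat) (f : (Xhat → ℝ) → ℝ) : (Xhat → ℝ) → ℝ :=
  fun r => fderiv ℝ f r (Pi.single j 1)

theorem Zf_add_smul_single (d : X → Xhat → ℝ) (r : Xhat → ℝ) (β : ℝ) (x : X) (j : Xhat) (t : ℝ) :
    Zf d (r + t • Pi.single j 1) β x = Zf d r β x + t * Real.exp (-β * d x j) := by
  simp [Zf, add_mul, Finset.sum_add_distrib, Pi.single_apply]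

theorem differentiable_Zf (d : X → Xhat → ℝ) (β : ℝ) (x : X) :
    Differentiable ℝ (fun r => Zf d r β x) := by
  unfold Zf
  fun_prop

/-- Repeated partial derivatives of the encoder, including the empty list of derivatives. -/
theorem foldr_pd_enc (d : X → Xhat → ℝ) (β : ℝ) (x : X) (xh : Xhat) (l : List Xhat)
    (r : Xhat → ℝ) (hZ : 0 < Zf d r β x) :
    l.foldr pd (fun r' => enc d r' β xh x) r =
      (-1 : ℝ) ^ l.length * Real.exp (-β * (l.map (d x)).sum) *
        (l.length.factorial * (r xh * Real.exp (-β * d x xh)) / Zf d r β x ^ (l.length + 1) -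
          (l.length - 1).factorial * (l.map fun i => if xh = i then (1 : ℝ) else 0).sum /
            Zf d r β x ^ l.length) := by
  induction l generalizing r with
  | nil => simp [enc]
  | cons j l ih =>
    have hnear : ∀ᶠ r' in nhds r, 0 < Zf d r' β x :=
      (differentiable_Zf d β x).continuous.continuousAt.eventually (lt_mem_nhds hZ)
    rw [List.foldr_cons, pd, Filter.EventuallyEq.fderiv_eq (hnear.mono ih)]
    simp only [List.length_cons, List.map_cons, List.sum_cons, Nat.add_sub_cancel]
    have hB : (l.length : ℝ) * (l.length - 1).factorial *
        (l.map fun i => if xh = i then (1 : ℝ) else 0).sum =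
        l.length.factorial * (l.map fun i => if xh = i then (1 : ℝ) else 0).sum := by
      cases l with
      | nil => simp
      | cons i l => simp [Nat.factorial_succ]
    generalize (l.map fun i => if xh = i then (1 : ℝ) else 0).sum = B at hB ⊢
    generalize l.length = k at hB ⊢
    have hZd := differentiable_Zf d β x
    have hZk (n : ℕ) : Zf d r β x ^ n ≠ 0 := (pow_pos hZ n).ne'
    rw [← DifferentiableAt.lineDeriv_eq_fderiv (by fun_prop (disch := exact hZk _)), lineDeriv]
    simp only [Zf_add_smul_single, Pi.add_apply, Pi.smul_apply, smul_eq_mul]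
    have hδ : (Pi.single j 1 : Xhat → ℝ) xh * Real.exp (-β * d x xh) =
        (if xh = j then 1 else 0) * Real.exp (-β * d x j) := by
      by_cases h : xh = j <;> simp [h]
    have hlin (a b : ℝ) : HasDerivAt (fun t : ℝ => a + t * b) b 0 := by
      simpa using ((hasDerivAt_id (0 : ℝ)).mul_const b).const_add a
    have hZline := hlin (Zf d r β x) (Real.exp (-β * d x j))
    have hne (n : ℕ) : (Zf d r β x + 0 * Real.exp (-β * d x j)) ^ n ≠ 0 := by
      simpa using hZk n
    have hderiv := ((((((hlin (r xh) ((Pi.single j 1 : Xhat → ℝ) xh)).mul_const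
      (Real.exp (-β * d x xh))).const_mul (k.factorial : ℝ)).div
        (hZline.pow (k + 1)) (hne _)).sub
      ((hasDerivAt_const (0 : ℝ) (((k - 1).factorial : ℝ) * B)).div
        (hZline.pow k) (hne _))).const_mul
          ((-1 : ℝ) ^ k * Real.exp (-β * (l.map (d x)).sum)))
    refine hderiv.deriv.trans ?_
    rw [hδ, mul_add, Real.exp_add, Nat.factorial_succ]
    simp only [Pi.pow_apply, zero_mul, add_zero, zero_sub, Nat.add_sub_cancel]
    generalize (if xh = j then (1 : ℝ) else 0) = δ
    have hpow : (k : ℝ) * Zf d r β x ^ (k - 1) * Zf d r β x = k * Zf d r β x ^ k := by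
      cases k with
      | zero => simp
      | succ k => simp [pow_succ]; ring
    have hpow' : (k : ℝ) * Zf d r β x ^ (k - 1) = k * Zf d r β x ^ k / Zf d r β x := by
      rw [eq_div_iff hZ.ne', hpow]
    have hZ0 := hZ.ne'
    rw [hpow']
    push_cast
    field_simp
    linear_combination (-1 : ℝ) ^ k * Zf d r β x ^ (3 * k + 4) * hB

/-- **Repeated derivatives of the encoder with respect to the marginal coordinates**
(Proposition `prop:repeated-encoder-deriv-wrt-coords`):
`∂^k q[r](x̂|x) / ∂r(x̂_{i₁})⋯∂r(x̂_{i_k}) =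
  [(−1)^{k−1}(k−1)! e^{−β ∑_j d(x,x̂_{i_j})} / Z(x,β)^k]·[∑_j δ_{x̂,x̂_{i_j}} − k·q[r](x̂|x)]`. -/
theorem encoderMarginalDerivs (d : X → Xhat → ℝ) (β : ℝ) (hβ : 0 < β)
    (x : X) (xh : Xhat) (r : Xhat → ℝ) (hZ : 0 < Zf d r β x)
    (k : ℕ) (hk : 1 ≤ k) (idx : Fin k → Xhat) :
    (List.ofFn idx).foldr pd (fun r' => enc d r' β xh x) r =
      ((-1 : ℝ) ^ (k - 1) * ((k - 1).factorial : ℝ) *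
          Real.exp (-β * ∑ j, d x (idx j)) / Zf d r β x ^ k) *
        ((∑ j, if xh = idx j then (1 : ℝ) else 0) - (k : ℝ) * enc d r β xh x) := by
  have hZ0 := hZ.ne'
  rw [foldr_pd_enc d β x xh _ r hZ]
  simp only [List.length_ofFn, List.map_ofFn, List.sum_ofFn, Function.comp_apply]
  obtain ⟨k, rfl⟩ : ∃ m, k = m + 1 := ⟨k - 1, by omega⟩
  generalize (∑ j, if xh = idx j then (1 : ℝ) else 0) = B
  simp only [Nat.add_sub_cancel, Nat.factorial_succ, enc]
  push_cast
  field_simp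
  ring
end

section
/- Let r be a probability distribution on 𝒳̂ and for β > 0 let q_β := q[r] be the associated encoder (well defined since Z(x,β) > 0 for every x). Then for every k ≥ 1, every β > 0, and every x ∈ 𝒳, x̂ ∈ 𝒳̂: ∂^k/∂β^k q_β(x̂|x) = q_β(x̂|x) · P_k[q_β; d](x̂, x). -/
open scoped BigOperators

variable {X Xhat : Type*} [Fintype X] [Fintype Xhat]

/-- The ℝ-linear derivation `d̄` on `ℝ[x₀, x₁, x₂, …]` determined by `d̄x₀ = 0` and
`d̄x_k = x₁·x_k − x_{k+1}` for `k ≥ 1`. -/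
noncomputable def dbar : Derivation ℝ (MvPolynomial ℕ ℝ) (MvPolynomial ℕ ℝ) :=
  MvPolynomial.mkDerivation ℝ fun k =>
    if k = 0 then 0 else MvPolynomial.X 1 * MvPolynomial.X k - MvPolynomial.X (k + 1)

/-- The polynomials `P_k`: `P₀ = 1`, `P_{k+1} = (x₁ − x₀)·P_k + d̄P_k`. -/
noncomputable def P : ℕ → MvPolynomial ℕ ℝ
  | 0 => 1
  | k + 1 => (MvPolynomial.X 1 - MvPolynomial.X 0) * P k + dbar (P k)

/-- `P_k[q; d](x̂, x)`: the polynomial `P_k` evaluated at `x₀ = d(x,x̂)` and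
`x_j = ∑_{x̂'} q(x̂'|x)·d(x,x̂')^j` for `j ≥ 1`. -/
noncomputable def Pval (d : X → Xhat → ℝ) (q : Xhat → X → ℝ) (k : ℕ) (xh : Xhat) (x : X) : ℝ :=
  MvPolynomial.eval
    (fun j => if j = 0 then d x xh else ∑ xh' : Xhat, q xh' x * d x xh' ^ j) (P k)

lemma MvPolynomial.hasDerivAt_eval_of_derivation {σ : Type*}
    (D : Derivation ℝ (MvPolynomial σ ℝ) (MvPolynomial σ ℝ)) (v : ℝ → σ → ℝ) (t : ℝ)
    (hv : ∀ i, HasDerivAt (fun s => v s i) (MvPolynomial.eval (v t) (D (MvPolynomial.X i))) t)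
    (p : MvPolynomial σ ℝ) :
    HasDerivAt (fun s => MvPolynomial.eval (v s) p) (MvPolynomial.eval (v t) (D p)) t := by
  induction p using MvPolynomial.induction_on with
  | C a => simpa using hasDerivAt_const t a
  | add p q hp hq => simpa using hp.fun_add hq
  | mul_X p i hp =>
    have h := hp.fun_mul (hv i)
    simp only [Derivation.leibniz, map_add, map_mul, smul_eq_mul, MvPolynomial.eval_X]
    exact h.congr_deriv (by ring)

lemma Zf_pos (d : X → Xhat → ℝ) {r : Xhat → ℝ} (hr0 : ∀ xh, 0 ≤ r xh)
    (hr1 : ∑ xh, r xh = 1) (β : ℝ) (x : X) : 0 < Zf d r β x := by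
  obtain ⟨a, ha, ha'⟩ := Finset.exists_ne_zero_of_sum_ne_zero (hr1.trans_ne one_ne_zero)
  exact Finset.sum_pos' (fun b _ => mul_nonneg (hr0 b) (Real.exp_pos _).le)
    ⟨a, ha, mul_pos ((hr0 a).lt_of_ne' ha') (Real.exp_pos _)⟩

lemma hasDerivAt_enc (d : X → Xhat → ℝ) {r : Xhat → ℝ} {β : ℝ} {x : X}
    (hZ : Zf d r β x ≠ 0) (xh : Xhat) :
    HasDerivAt (fun b => enc d r b xh x)
      (enc d r β xh x * (∑ a, enc d r β a x * d x a - d x xh)) β := by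
  have hnum (a : Xhat) : HasDerivAt (fun b => r a * Real.exp (-b * d x a))
      (-(r a * Real.exp (-β * d x a) * d x a)) β :=
    ((((hasDerivAt_id β).neg.mul_const (d x a)).exp).const_mul (r a)).congr_deriv (by simp; ring)
  have hden : HasDerivAt (fun b => Zf d r b x)
      (∑ a, -(r a * Real.exp (-β * d x a) * d x a)) β :=
    HasDerivAt.fun_sum fun a _ => hnum a
  have hmean : ∑ a, enc d r β a x * d x a =
      (∑ a, r a * Real.exp (-β * d x a) * d x a) / Zf d r β x := by
    rw [Finset.sum_div]
    exact Finset.sum_congr rfl fun a _ => by rw [enc]; ring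
  refine ((hnum xh).fun_div hden hZ).congr_deriv ?_
  rw [hmean, enc, Finset.sum_neg_distrib]
  field_simp
  ring

lemma hasDerivAt_Pval_enc (d : X → Xhat → ℝ) {r : Xhat → ℝ} {β : ℝ} {x : X}
    (hZ : Zf d r β x ≠ 0) (k : ℕ) (xh : Xhat) :
    HasDerivAt (fun b => Pval d (enc d r b) k xh x)
      (MvPolynomial.eval (fun j => if j = 0 then d x xh else
        ∑ a, enc d r β a x * d x a ^ j) (dbar (P k))) β := by
  refine MvPolynomial.hasDerivAt_eval_of_derivation dbar
    (fun b j => if j = 0 then d x xh else ∑ a, enc d r b a x * d x a ^ j) β (fun j => ?_) (P k)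
  rcases eq_or_ne j 0 with rfl | hj
  · simpa [dbar, MvPolynomial.mkDerivation_X] using hasDerivAt_const β (d x xh)
  · have h := HasDerivAt.fun_sum (u := Finset.univ) fun a _ =>
      (hasDerivAt_enc d hZ a).mul_const (d x a ^ j)
    simp only [dbar, MvPolynomial.mkDerivation_X, hj, if_false, map_sub, map_mul,
      MvPolynomial.eval_X, one_ne_zero, Nat.succ_ne_zero, pow_one]
    refine h.congr_deriv ?_
    rw [Finset.mul_sum, ← Finset.sum_sub_distrib]
    exact Finset.sum_congr rfl fun a _ => by ring

lemma iteratedDeriv_enc (d : X → Xhat → ℝ) {r : Xhat → ℝ} {x : X}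
    (hZ : ∀ β, Zf d r β x ≠ 0) (k : ℕ) (xh : Xhat) :
    iteratedDeriv k (fun b => enc d r b xh x) =
      fun b => enc d r b xh x * Pval d (enc d r b) k xh x := by
  induction k with
  | zero => simp [Pval, P]
  | succ k ih =>
    funext β
    rw [iteratedDeriv_succ, ih,
      ((hasDerivAt_enc d (hZ β) xh).fun_mul (hasDerivAt_Pval_enc d (hZ β) k xh)).deriv]
    simp only [Pval, P, map_add, map_mul, map_sub, MvPolynomial.eval_X, if_true, one_ne_zero,
      if_false, pow_one]
    ring

/-- **Repeated `β`-derivatives of the encoder** (Proposition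
`prop:repeated-beta-derivatives-of-encoder`): for a probability distribution `r` on `𝒳̂`,
`∂^k/∂β^k q_β(x̂|x) = q_β(x̂|x) · P_k[q_β; d](x̂, x)` for every `k ≥ 1`, `β > 0`. -/
theorem encoderBetaDerivs (d : X → Xhat → ℝ) (r : Xhat → ℝ)
    (hr0 : ∀ xh, 0 ≤ r xh) (hr1 : ∑ xh, r xh = 1) :
    ∀ k : ℕ, 1 ≤ k → ∀ β : ℝ, 0 < β → ∀ (x : X) (xh : Xhat),
      iteratedDeriv k (fun β' => enc d r β' xh x) β =
        enc d r β xh x * Pval d (fun a c => enc d r β a c) k xh x := by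
  intro k _ β _ x xh
  exact congrFun (iteratedDeriv_enc d (fun b => (Zf_pos d hr0 hr1 b x).ne') k xh) β
end

section
/- Let β > 0 and let q be a conditional distribution (each q(·|x) a probability distribution on 𝒳̂), with marginal s(x̂) = ∑_x p_X(x)·q(x̂|x). Then, viewing BA_β as a map on ℝ^{𝒳̂×𝒳} in encoder coordinates, its partial derivatives at q are given by ∂ BA_β[q](x̂|x) / ∂ q(x̂'|x') = [ e^{−β d(x,x̂')} / ∑_{x̂''} s(x̂'')·e^{−β d(x,x̂'')} ] · [ δ_{x̂,x̂'} − BA_β[q](x̂|x) ] · p_X(x') for all x̂, x̂' ∈ 𝒳̂ and x, x' ∈ 𝒳, where δ is the Kronecker delta. -/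
open scoped BigOperators

variable {X Xhat : Type*} [Fintype X] [Fintype Xhat] [DecidableEq X] [DecidableEq Xhat]

/-- The marginal `s(x̂) = ∑_x p_X(x)·q(x̂|x)` of a conditional distribution `q`. -/
noncomputable def marg (p : X → ℝ) (q : Xhat → X → ℝ) (xh : Xhat) : ℝ :=
  ∑ x : X, p x * q xh x

/-- The Blahut–Arimoto iteration in encoder coordinates:
`BA_β[q](x̂|x) = s(x̂)·e^{−β d(x,x̂)} / ∑_{x̂''} s(x̂'')·e^{−β d(x,x̂'')}`. -/
noncomputable def BAenc (p : X → ℝ) (d : X → Xhat → ℝ) (β : ℝ) (q : Xhat → X → ℝ)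
    (xh : Xhat) (x : X) : ℝ :=
  marg p q xh * Real.exp (-β * d x xh) /
    ∑ xh'' : Xhat, marg p q xh'' * Real.exp (-β * d x xh'')

/-- Partial derivative of a function of the encoder `q ∈ ℝ^{𝒳̂×𝒳}` with respect to the
coordinate `q(x̂'|x')`. -/
noncomputable def pQ (xh' : Xhat) (x' : X) (f : (Xhat → X → ℝ) → ℝ) : (Xhat → X → ℝ) → ℝ :=
  fun q => fderiv ℝ f q (Pi.single xh' (Pi.single x' 1))

/-- The marginal `marg p q xh`, as a continuous linear functional of the encoder `q`. -/
noncomputable def margCLM (p : X → ℝ) (xh : Xhat) : (Xhat → X → ℝ) →L[ℝ] ℝ :=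
  ∑ x : X, p x • (ContinuousLinearMap.proj (R := ℝ) (φ := fun _ : X => ℝ) x).comp
    (ContinuousLinearMap.proj (R := ℝ) (φ := fun _ : Xhat => X → ℝ) xh)

theorem margCLM_apply {X Xhat : Type*} [Fintype X]
    (p : X → ℝ) (xh : Xhat) (q : Xhat → X → ℝ) :
    margCLM p xh q = marg p q xh := by
  simp [margCLM, marg]

theorem marg_single {X Xhat : Type*} [Fintype X] [DecidableEq X] [DecidableEq Xhat]
    (p : X → ℝ) (xh xh' : Xhat) (x' : X) :
    marg p (Pi.single xh' (Pi.single x' 1)) xh = if xh = xh' then p x' else 0 := by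
  by_cases h : xh = xh'
  · subst h
    simp [marg, Pi.single_apply]
  · simp [marg, h]

theorem hasFDerivAt_marg_mul {X Xhat : Type*} [Fintype X] [Fintype Xhat]
    (p : X → ℝ) (xh : Xhat) (c : ℝ) (q : Xhat → X → ℝ) :
    HasFDerivAt (fun q' => marg p q' xh * c) (c • margCLM p xh) q := by
  have h := ((margCLM p xh).hasFDerivAt (x := q)).mul_const c
  simpa only [margCLM_apply] using h

theorem sum_marg {X Xhat : Type*} [Fintype X] [Fintype Xhat]
    (p : X → ℝ) (hp1 : ∑ x, p x = 1) (q : Xhat → X → ℝ)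
    (hq : ∀ x, ∑ xh, q xh x = 1) : ∑ xh, marg p q xh = 1 := by
  simp only [marg]
  rw [Finset.sum_comm]
  simp [← Finset.mul_sum, hq, hp1]

/-- The normalizing denominator of the Blahut–Arimoto iteration is positive. -/
theorem sum_marg_mul_exp_pos {X Xhat : Type*} [Fintype X] [Fintype Xhat]
    (p : X → ℝ) (hp0 : ∀ x, 0 ≤ p x) (hp1 : ∑ x, p x = 1)
    (q : Xhat → X → ℝ) (hq : ∀ x, (∀ xh, 0 ≤ q xh x) ∧ ∑ xh, q xh x = 1) (f : Xhat → ℝ) :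
    0 < ∑ xh, marg p q xh * Real.exp (f xh) := by
  have hnonneg : ∀ xh, 0 ≤ marg p q xh := fun xh =>
    Finset.sum_nonneg fun x _ => mul_nonneg (hp0 x) ((hq x).1 xh)
  have hsum : 0 < ∑ xh, marg p q xh := by
    rw [sum_marg p hp1 q fun x => (hq x).2]
    exact one_pos
  obtain ⟨xh, -, hpos⟩ := Finset.exists_lt_of_sum_lt (s := Finset.univ)
    (f := fun _ : Xhat => (0 : ℝ)) (by simpa using hsum)
  exact Finset.sum_pos' (fun y _ => mul_nonneg (hnonneg y) (Real.exp_pos _).le)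
    ⟨xh, Finset.mem_univ _, mul_pos hpos (Real.exp_pos _)⟩

/-- **The Jacobian of `BA_β` in encoder coordinates** (Proposition
`prop:Jacobian-of-BA-in-direct-encoder-coordinates`):
`∂BA_β[q](x̂|x)/∂q(x̂'|x') = [e^{−β d(x,x̂')}/∑_{x̂''} s(x̂'')e^{−β d(x,x̂'')}]·
  [δ_{x̂,x̂'} − BA_β[q](x̂|x)]·p(x')`. -/
theorem jacobianBAEncoder (p : X → ℝ) (hp0 : ∀ x, 0 ≤ p x) (hp1 : ∑ x, p x = 1)
    (d : X → Xhat → ℝ) (β : ℝ) (hβ : 0 < β)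
    (q : Xhat → X → ℝ) (hq : ∀ x, (∀ xh, 0 ≤ q xh x) ∧ ∑ xh, q xh x = 1)
    (xh xh' : Xhat) (x x' : X) :
    pQ xh' x' (fun q' => BAenc p d β q' xh x) q =
      (Real.exp (-β * d x xh') / ∑ xh'' : Xhat, marg p q xh'' * Real.exp (-β * d x xh'')) *
        ((if xh = xh' then (1 : ℝ) else 0) - BAenc p d β q xh x) * p x' := by
  have hpos := sum_marg_mul_exp_pos p hp0 hp1 q hq (fun y => -β * d x y)
  have hden : HasFDerivAt (fun q' => ∑ y, marg p q' y * Real.exp (-β * d x y))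
      (∑ y, Real.exp (-β * d x y) • margCLM p y) q :=
    HasFDerivAt.fun_sum fun y _ => hasFDerivAt_marg_mul p y _ q
  have hdiv := (hasFDerivAt_marg_mul p xh (Real.exp (-β * d x xh)) q).mul
    ((hasDerivAt_inv hpos.ne').comp_hasFDerivAt q hden)
  simp only [pQ, BAenc, div_eq_mul_inv]
  rw [HasFDerivAt.fderiv (f := fun q' => _ * _) hdiv]
  simp only [Function.comp_apply, smul_apply, add_apply,
    sum_apply, margCLM_apply, marg_single, smul_eq_mul, mul_ite, mul_zero,
    Finset.sum_ite_eq', Finset.mem_univ, if_true]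
  have hne := hpos.ne'
  generalize ∑ y, marg p q y * Real.exp (-β * d x y) = Z at hne ⊢
  split_ifs with h
  · subst h
    field_simp
    ring
  · field_simp
    ring
end
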